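/- A braided crossed module of Lie K-algebras admits a universal central extension if and only if it is perfect. -/

import Mathlib

universe u

/-- The Lie bracket as a bilinear map. -/
def bracketMap (K : Type u) [CommRing K] (M : Type u) [LieRing M] [LieAlgebra K M] :
    M →ₗ[K] M →ₗ[K] M :=
  LinearMap.mk₂ K (fun a b => ⁅a, b⁆) add_lie smul_lie lie_add lie_smul

/-- Axioms for a crossed module of Lie `K`-algebras `(d : M → N, act)`. -/
structure LieXMod (K : Type u) [CommRing K] (M N : Type u)
    [LieRing M] [LieAlgebra K M] [LieRing N] [LieAlgebra K N]
    (d : M →ₗ⁅K⁆ N) (act : N →ₗ[K] M →ₗ[K] M) : Prop where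
  act_lie : ∀ n n' m, act ⁅n, n'⁆ m = act n (act n' m) - act n' (act n m)
  lie_act : ∀ n m m', act n ⁅m, m'⁆ = ⁅act n m, m'⁆ + ⁅m, act n m'⁆
  equivar : ∀ n m, d (act n m) = ⁅n, d m⁆
  peiffer : ∀ m m', act (d m) m' = ⁅m, m'⁆

/-- Axioms `BLie1`–`BLie6` for a braiding on a crossed module of Lie algebras. -/
structure LieBraiding (K : Type u) [CommRing K] (M N : Type u)
    [LieRing M] [LieAlgebra K M] [LieRing N] [LieAlgebra K N]
    (d : M →ₗ⁅K⁆ N) (act : N →ₗ[K] M →ₗ[K] M)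
    (br : N →ₗ[K] N →ₗ[K] M) : Prop where
  b1 : ∀ n n', d (br n n') = ⁅n, n'⁆
  b2 : ∀ m m', br (d m) (d m') = ⁅m, m'⁆
  b3 : ∀ m n, br (d m) n = - act n m
  b4 : ∀ n m, br n (d m) = act n m
  b5 : ∀ n n' n'', br n ⁅n', n''⁆ = br ⁅n, n'⁆ n'' - br ⁅n, n''⁆ n'
  b6 : ∀ n n' n'', br ⁅n, n'⁆ n'' = br n ⁅n', n''⁆ - br n' ⁅n, n''⁆

/-- `T`, together with the bilinear pairing `t`, is the non-abelian tensor product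
of the Lie algebras `A` and `B` acting on each other via `actAB` and `actBA`:
it satisfies the defining relations of the presentation and the universal property. -/
structure IsNATensor (K : Type u) [CommRing K] (A B : Type u)
    [LieRing A] [LieAlgebra K A] [LieRing B] [LieAlgebra K B]
    (actAB : A →ₗ[K] B →ₗ[K] B) (actBA : B →ₗ[K] A →ₗ[K] A)
    (T : Type u) [LieRing T] [LieAlgebra K T]
    (t : A →ₗ[K] B →ₗ[K] T) : Prop where
  rel3a : ∀ a a' b, t ⁅a, a'⁆ b = t a (actAB a' b) - t a' (actAB a b)
  rel3b : ∀ a b b', t a ⁅b, b'⁆ = t (actBA b' a) b - t (actBA b a) b'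
  rel4 : ∀ a b a' b', ⁅t a b, t a' b'⁆ = - t (actBA b a) (actAB a' b')
  lift : ∀ (C : Type u) [LieRing C] [LieAlgebra K C] (f : A →ₗ[K] B →ₗ[K] C),
      (∀ a a' b, f ⁅a, a'⁆ b = f a (actAB a' b) - f a' (actAB a b)) →
      (∀ a b b', f a ⁅b, b'⁆ = f (actBA b' a) b - f (actBA b a) b') →
      (∀ a b a' b', ⁅f a b, f a' b'⁆ = - f (actBA b a) (actAB a' b')) →
      ∃! φ : T →ₗ⁅K⁆ C, ∀ a b, φ (t a b) = f a b

/-- `T` with pairing `t` is the non-abelian tensor square of `N` (adjoint actions). -/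
def IsNATensorSq (K : Type u) [CommRing K] (N : Type u) [LieRing N] [LieAlgebra K N]
    (T : Type u) [LieRing T] [LieAlgebra K T] (t : N →ₗ[K] N →ₗ[K] T) : Prop :=
  IsNATensor K N N (bracketMap K N) (bracketMap K N) T t


/-- A central extension of braided crossed modules over the braided crossed module
`(d : M → N, act, br)`: a braided crossed module `(δ : X₁ → X₂, actX, brX)` together with a
surjective morphism `(f₁, f₂)` whose kernel lies in the braided center. -/
structure CentralExtOf (K : Type u) [CommRing K] (M N : Type u)
    [LieRing M] [LieAlgebra K M] [LieRing N] [LieAlgebra K N]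
    (d : M →ₗ⁅K⁆ N) (act : N →ₗ[K] M →ₗ[K] M) (br : N →ₗ[K] N →ₗ[K] M) :
    Type (u + 1) where
  X₁ : Type u
  X₂ : Type u
  [ringX₁ : LieRing X₁]
  [algX₁ : LieAlgebra K X₁]
  [ringX₂ : LieRing X₂]
  [algX₂ : LieAlgebra K X₂]
  δ : X₁ →ₗ⁅K⁆ X₂
  actX : X₂ →ₗ[K] X₁ →ₗ[K] X₁
  brX : X₂ →ₗ[K] X₂ →ₗ[K] X₁
  isXMod : LieXMod K X₁ X₂ δ actX
  isBraid : LieBraiding K X₁ X₂ δ actX brX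
  f₁ : X₁ →ₗ⁅K⁆ M
  f₂ : X₂ →ₗ⁅K⁆ N
  morph_act : ∀ (x : X₂) (ξ : X₁), f₁ (actX x ξ) = act (f₂ x) (f₁ ξ)
  morph_d : ∀ ξ : X₁, d (f₁ ξ) = f₂ (δ ξ)
  morph_br : ∀ x y : X₂, f₁ (brX x y) = br (f₂ x) (f₂ y)
  surj₁ : Function.Surjective f₁
  surj₂ : Function.Surjective f₂
  central₁ : ∀ ξ : X₁, f₁ ξ = 0 → ∀ x : X₂, actX x ξ = 0
  central₂ : ∀ x : X₂, f₂ x = 0 → ∀ y : X₂, brX x y = 0 ∧ brX y x = 0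

attribute [instance] CentralExtOf.ringX₁ CentralExtOf.algX₁
  CentralExtOf.ringX₂ CentralExtOf.algX₂

/-- Underlying type of the product of a Lie algebra with an abelian one. -/
def TrivExt (M A : Type u) : Type u := M × A

instance (M A : Type u) [LieRing M] [AddCommGroup A] : AddCommGroup (TrivExt M A) :=
  inferInstanceAs (AddCommGroup (M × A))

instance (K M A : Type u) [CommRing K] [LieRing M] [LieAlgebra K M] [AddCommGroup A]
    [Module K A] : Module K (TrivExt M A) :=
  inferInstanceAs (Module K (M × A))

instance (M A : Type u) [LieRing M] [AddCommGroup A] : LieRing (TrivExt M A) where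
  bracket x y := ((⁅x.1, y.1⁆, 0) : M × A)
  add_lie x y z := Prod.ext (add_lie x.1 y.1 z.1) (add_zero (0 : A)).symm
  lie_add x y z := Prod.ext (lie_add x.1 y.1 z.1) (add_zero (0 : A)).symm
  lie_self x := Prod.ext (lie_self x.1) rfl
  leibniz_lie x y z := Prod.ext (leibniz_lie x.1 y.1 z.1) (add_zero (0 : A)).symm

instance (K M A : Type u) [CommRing K] [LieRing M] [LieAlgebra K M] [AddCommGroup A]
    [Module K A] : LieAlgebra K (TrivExt M A) where
  lie_smul r x y := Prod.ext (lie_smul r x.1 y.1) (smul_zero r).symm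

/-- first projection -/
def TrivExt.fstH (K M A : Type u) [CommRing K] [LieRing M] [LieAlgebra K M] [AddCommGroup A]
    [Module K A] : TrivExt M A →ₗ⁅K⁆ M :=
  { LinearMap.fst K M A with map_lie' := rfl }

/-- bilinear map into the first factor -/
def TrivExt.bil {K M N P A B C : Type u} [CommRing K] [LieRing M] [LieAlgebra K M]
    [LieRing N] [LieAlgebra K N] [LieRing P] [LieAlgebra K P]
    [AddCommGroup A] [Module K A] [AddCommGroup B] [Module K B] [AddCommGroup C] [Module K C]
    (f : M →ₗ[K] N →ₗ[K] P) : TrivExt M A →ₗ[K] TrivExt N B →ₗ[K] TrivExt P C :=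
  LinearMap.mk₂ K (fun x y => ((f x.1 y.1, 0) : P × C))
    (fun x y z => Prod.ext (f.map_add₂ x.1 y.1 z.1) (add_zero (0 : C)).symm)
    (fun r x y => Prod.ext (f.map_smul₂ r x.1 y.1) (smul_zero r).symm)
    (fun x y z => Prod.ext ((f x.1).map_add y.1 z.1) (add_zero (0 : C)).symm)
    (fun r x y => Prod.ext ((f x.1).map_smul r y.1) (smul_zero r).symm)

/-- pairing a Lie map with a linear map killing brackets -/
def TrivExt.pair {K L M A : Type u} [CommRing K] [LieRing L] [LieAlgebra K L]
    [LieRing M] [LieAlgebra K M] [AddCommGroup A] [Module K A]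
    (f : L →ₗ⁅K⁆ M) (p : L →ₗ[K] A) (hp : ∀ x y : L, p ⁅x, y⁆ = 0) : L →ₗ⁅K⁆ TrivExt M A :=
  { LinearMap.prod (f : L →ₗ[K] M) p with
    map_lie' := fun {x y} => Prod.ext (f.map_lie x y) (hp x y) }

/-- product of Lie map and linear map -/
def TrivExt.map {K M N A B : Type u} [CommRing K] [LieRing N] [LieAlgebra K N]
    [LieRing M] [LieAlgebra K M] [AddCommGroup A] [Module K A] [AddCommGroup B] [Module K B]
    (f : M →ₗ⁅K⁆ N) (p : A →ₗ[K] B) : TrivExt M A →ₗ⁅K⁆ TrivExt N B :=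
  { LinearMap.prodMap (f : M →ₗ[K] N) p with
    map_lie' := fun {x y} => Prod.ext (f.map_lie x.1 y.1) (p.map_zero) }

/-- trivial central extension -/
def trivCE {K M N A C : Type u} [CommRing K] [LieRing M] [LieAlgebra K M]
    [LieRing N] [LieAlgebra K N] {d : M →ₗ⁅K⁆ N} {act : N →ₗ[K] M →ₗ[K] M}
    {br : N →ₗ[K] N →ₗ[K] M} (hX : LieXMod K M N d act)
    (hB : LieBraiding K M N d act br) [AddCommGroup A] [Module K A] [AddCommGroup C] [Module K C]
    (e : A →ₗ[K] C) : CentralExtOf K M N d act br where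
  X₁ := TrivExt M A
  X₂ := TrivExt N C
  δ := TrivExt.map d e
  actX := TrivExt.bil act
  brX := TrivExt.bil br
  isXMod :=
    { act_lie := fun n n' m => Prod.ext (hX.act_lie n.1 n'.1 m.1) (sub_zero (0 : A)).symm
      lie_act := fun n m m' => Prod.ext (hX.lie_act n.1 m.1 m'.1) (add_zero (0 : A)).symm
      equivar := fun n m => Prod.ext (hX.equivar n.1 m.1) e.map_zero
      peiffer := fun m m' => Prod.ext (hX.peiffer m.1 m'.1) rfl }
  isBraid :=
    { b1 := fun n n' => Prod.ext (hB.b1 n.1 n'.1) e.map_zero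
      b2 := fun m m' => Prod.ext (hB.b2 m.1 m'.1) rfl
      b3 := fun m n => Prod.ext (hB.b3 m.1 n.1) (neg_zero (G := A)).symm
      b4 := fun n m => Prod.ext (hB.b4 n.1 m.1) rfl
      b5 := fun n n' m => Prod.ext (hB.b5 n.1 n'.1 m.1) (sub_zero (0 : A)).symm
      b6 := fun n n' m => Prod.ext (hB.b6 n.1 n'.1 m.1) (sub_zero (0 : A)).symm }
  f₁ := TrivExt.fstH K M A
  f₂ := TrivExt.fstH K N C
  morph_act _ _ := rfl
  morph_d _ := rfl
  morph_br _ _ := rfl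
  surj₁ m := ⟨((m, 0) : M × A), rfl⟩
  surj₂ m := ⟨((m, 0) : N × C), rfl⟩
  central₁ ξ h x := Prod.ext (show act x.1 ξ.1 = 0 by
    rw [show ξ.1 = 0 from h, map_zero]) rfl
  central₂ x h y := ⟨Prod.ext (show br x.1 y.1 = 0 by
    rw [show x.1 = 0 from h, map_zero, LinearMap.zero_apply]) rfl,
    Prod.ext (show br y.1 x.1 = 0 by rw [show x.1 = 0 from h, map_zero]) rfl⟩

/-- morphisms over the base -/
def IsMor {K M N : Type u} [CommRing K] [LieRing M] [LieAlgebra K M]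
    [LieRing N] [LieAlgebra K N] {d : M →ₗ⁅K⁆ N} {act : N →ₗ[K] M →ₗ[K] M}
    {br : N →ₗ[K] N →ₗ[K] M} (E F : CentralExtOf K M N d act br)
    (h : (E.X₁ →ₗ⁅K⁆ F.X₁) × (E.X₂ →ₗ⁅K⁆ F.X₂)) : Prop :=
  (∀ (x : E.X₂) (ξ : E.X₁), h.1 (E.actX x ξ) = F.actX (h.2 x) (h.1 ξ)) ∧
            (∀ ξ : E.X₁, F.δ (h.1 ξ) = h.2 (E.δ ξ)) ∧
            (∀ x y : E.X₂, h.1 (E.brX x y) = F.brX (h.2 x) (h.2 y)) ∧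
            (∀ ξ : E.X₁, F.f₁ (h.1 ξ) = E.f₁ ξ) ∧
            (∀ x : E.X₂, F.f₂ (h.2 x) = E.f₂ x)

theorem perfect_of_univ {K M N : Type u} [CommRing K] [LieRing M] [LieAlgebra K M]
    [LieRing N] [LieAlgebra K N] {d : M →ₗ⁅K⁆ N} {act : N →ₗ[K] M →ₗ[K] M}
    {br : N →ₗ[K] N →ₗ[K] M} (hX : LieXMod K M N d act)
    (hB : LieBraiding K M N d act br) (E : CentralExtOf K M N d act br)
    (hE : ∀ F, ∃! h, IsMor E F h) :
    Submodule.span K {x : M | ∃ n n' : N, x = br n n'} = ⊤ ∧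
    Submodule.span K {x : N | ∃ a b : N, x = ⁅a, b⁆} = ⊤ := by
  set S := Submodule.span K {x : M | ∃ n n' : N, x = br n n'} with hS
  set R := Submodule.span K {x : N | ∃ a b : N, x = ⁅a, b⁆} with hR
  have hSm : ∀ n n', br n n' ∈ S := fun n n' => Submodule.subset_span ⟨n, n', rfl⟩
  have hRm : ∀ n n' : N, ⁅n, n'⁆ ∈ R := fun n n' => Submodule.subset_span ⟨n, n', rfl⟩
  have hle : S ≤ R.comap (d : M →ₗ[K] N) := by
    rw [hS, Submodule.span_le]
    rintro _ ⟨n, n', rfl⟩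
    show d (br n n') ∈ R
    rw [hB.b1]; exact hRm _ _
  let e : (M ⧸ S) →ₗ[K] (N ⧸ R) := S.mapQ R (d : M →ₗ[K] N) hle
  let F := trivCE hX hB e
  let p : E.X₁ →ₗ[K] M ⧸ S := S.mkQ ∘ₗ (E.f₁ : E.X₁ →ₗ[K] M)
  let q : E.X₂ →ₗ[K] N ⧸ R := R.mkQ ∘ₗ (E.f₂ : E.X₂ →ₗ[K] N)
  have pbr : ∀ x y, p (E.brX x y) = 0 := fun x y => by
    show S.mkQ (E.f₁ (E.brX x y)) = 0
    rw [E.morph_br, Submodule.mkQ_apply, Submodule.Quotient.mk_eq_zero]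
    exact hSm _ _
  have pact : ∀ x y, p (E.actX x y) = 0 := fun x y => by
    rw [← E.isBraid.b4, pbr]
  have pl : ∀ x y : E.X₁, p ⁅x, y⁆ = 0 := fun x y => by rw [← E.isBraid.b2, pbr]
  have ql : ∀ x y : E.X₂, q ⁅x, y⁆ = 0 := fun x y => by
    show R.mkQ (E.f₂ ⁅x, y⁆) = 0
    rw [LieHom.map_lie, Submodule.mkQ_apply, Submodule.Quotient.mk_eq_zero]
    exact hRm _ _
  have epq : ∀ ξ, e (p ξ) = q (E.δ ξ) := fun ξ => by
    show R.mkQ (d (E.f₁ ξ)) = R.mkQ (E.f₂ (E.δ ξ))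
    rw [E.morph_d]
  have m1 : IsMor E F (TrivExt.pair E.f₁ p pl, TrivExt.pair E.f₂ q ql) :=
    ⟨fun x ξ => Prod.ext (E.morph_act x ξ) (pact x ξ),
     fun ξ => Prod.ext (E.morph_d ξ) (epq ξ),
     fun x y => Prod.ext (E.morph_br x y) (pbr x y), fun _ => rfl, fun _ => rfl⟩
  have m2 : IsMor E F (TrivExt.pair E.f₁ 0 (fun _ _ => rfl),
      TrivExt.pair E.f₂ 0 (fun _ _ => rfl)) :=
    ⟨fun x ξ => Prod.ext (E.morph_act x ξ) rfl,
     fun ξ => Prod.ext (E.morph_d ξ) e.map_zero,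
     fun x y => Prod.ext (E.morph_br x y) rfl, fun _ => rfl, fun _ => rfl⟩
  have heq := (hE F).unique m1 m2
  constructor
  · rw [eq_top_iff]
    intro m _
    obtain ⟨ξ, rfl⟩ := E.surj₁ m
    have h := congrArg Prod.snd (LieHom.congr_fun (congrArg Prod.fst heq) ξ :
      (_ : M × (M ⧸ S)) = _)
    exact (Submodule.Quotient.mk_eq_zero S).1 h
  · rw [eq_top_iff]
    intro m _
    obtain ⟨ξ, rfl⟩ := E.surj₂ m
    have h := congrArg Prod.snd (LieHom.congr_fun (congrArg Prod.snd heq) ξ :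
      (_ : N × (N ⧸ R)) = _)
    exact (Submodule.Quotient.mk_eq_zero R).1 h

theorem brX_congr {K M N : Type u} [CommRing K] [LieRing M] [LieAlgebra K M]
    [LieRing N] [LieAlgebra K N] {d : M →ₗ⁅K⁆ N} {act : N →ₗ[K] M →ₗ[K] M}
    {br : N →ₗ[K] N →ₗ[K] M} (F : CentralExtOf K M N d act br) {x x' y y' : F.X₂}
    (hx : F.f₂ x = F.f₂ x') (hy : F.f₂ y = F.f₂ y') : F.brX x y = F.brX x' y' := by
  have h1 := (F.central₂ (x - x') (by rw [map_sub, hx, sub_self]) y).1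
  have h2 := (F.central₂ (y - y') (by rw [map_sub, hy, sub_self]) x').2
  rw [map_sub, LinearMap.sub_apply, sub_eq_zero] at h1
  rw [map_sub, sub_eq_zero] at h2
  rw [h1, h2]

theorem exists_pairing {K M N : Type u} [CommRing K] [LieRing M] [LieAlgebra K M]
    [LieRing N] [LieAlgebra K N] {d : M →ₗ⁅K⁆ N} {act : N →ₗ[K] M →ₗ[K] M}
    {br : N →ₗ[K] N →ₗ[K] M} (F : CentralExtOf K M N d act br) :
    ∃ s : N →ₗ[K] N →ₗ[K] F.X₁, ∀ x y, s (F.f₂ x) (F.f₂ y) = F.brX x y := by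
  have hs : ∀ n, F.f₂ (Function.surjInv F.surj₂ n) = n := Function.surjInv_eq F.surj₂
  refine ⟨LinearMap.mk₂ K (fun n n' => F.brX (Function.surjInv F.surj₂ n)
    (Function.surjInv F.surj₂ n')) ?_ ?_ ?_ ?_, fun x y => ?_⟩
  · intro a b c
    rw [← LinearMap.add_apply, ← map_add]
    exact brX_congr F (by simp only [map_add, hs]) rfl
  · intro r a b
    rw [← LinearMap.smul_apply, ← map_smul]
    exact brX_congr F (by simp only [map_smul, hs]) rfl
  · intro a b c
    rw [← map_add]
    exact brX_congr F rfl (by simp only [map_add, hs])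
  · intro r a b
    rw [← map_smul]
    exact brX_congr F rfl (by simp only [map_smul, hs])
  · exact brX_congr F (hs _) (hs _)

section tensor
variable {K N T : Type u} [CommRing K] [LieRing N] [LieAlgebra K N] [LieRing T] [LieAlgebra K T]
  {t : N →ₗ[K] N →ₗ[K] T}

theorem bracketMap_ap (a b : N) : bracketMap K N a b = ⁅a, b⁆ := rfl

theorem tensor_rel4 (hT : IsNATensorSq K N T t) (a b a' b' : N) :
    ⁅t a b, t a' b'⁆ = t ⁅a, b⁆ ⁅a', b'⁆ := by
  rw [hT.rel4, bracketMap_ap, bracketMap_ap, ← lie_skew a b, map_neg, LinearMap.neg_apply]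

theorem tensor_lift (hT : IsNATensorSq K N T t) (C : Type u) [LieRing C] [LieAlgebra K C]
    (f : N →ₗ[K] N →ₗ[K] C)
    (h5 : ∀ n n' n'', f n ⁅n', n''⁆ = f ⁅n, n'⁆ n'' - f ⁅n, n''⁆ n')
    (h6 : ∀ n n' n'', f ⁅n, n'⁆ n'' = f n ⁅n', n''⁆ - f n' ⁅n, n''⁆)
    (h4 : ∀ a b a' b', ⁅f a b, f a' b'⁆ = f ⁅a, b⁆ ⁅a', b'⁆) :
    ∃! φ : T →ₗ⁅K⁆ C, ∀ a b, φ (t a b) = f a b := by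
  apply hT.lift C f
  · intro a a' b; exact h6 _ _ _
  · intro a b b'
    rw [bracketMap_ap, bracketMap_ap, h5, ← lie_skew b' a, ← lie_skew b a]
    simp only [map_neg, LinearMap.neg_apply]; abel
  · intro a b a' b'
    rw [bracketMap_ap, bracketMap_ap, h4, ← lie_skew a b, map_neg, LinearMap.neg_apply]

/-- `T` is spanned, as a Lie algebra, by the image of `t`. -/
theorem tensor_span (hT : IsNATensorSq K N T t) :
    LieSubalgebra.lieSpan K T {x | ∃ a b, x = t a b} = ⊤ := by
  set L := LieSubalgebra.lieSpan K T {x | ∃ a b, x = t a b} with hL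
  have hm : ∀ a b, t a b ∈ L := fun a b => LieSubalgebra.subset_lieSpan ⟨a, b, rfl⟩
  let f : N →ₗ[K] N →ₗ[K] L := LinearMap.mk₂ K (fun a b => ⟨t a b, hm a b⟩)
    (fun _ _ _ => Subtype.ext (by simp)) (fun _ _ _ => Subtype.ext (by simp))
    (fun _ _ _ => Subtype.ext (by simp)) (fun _ _ _ => Subtype.ext (by simp))
  obtain ⟨φ, hφ, -⟩ := hT.lift L f (fun a a' b => Subtype.ext (hT.rel3a a a' b))
    (fun a a' b => Subtype.ext (hT.rel3b a a' b))
    (fun a b a' b' => Subtype.ext (hT.rel4 a b a' b'))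
  have := (hT.lift T t hT.rel3a hT.rel3b hT.rel4).unique
    (y₁ := L.incl.comp φ) (y₂ := LieHom.id) (fun a b => by
      show ((φ (t a b) : L) : T) = _
      rw [hφ]; rfl) (fun a b => rfl)
  rw [eq_top_iff]
  intro x _
  have h := LieHom.congr_fun this x
  have h' : ((φ x : L) : T) = x := h
  rw [← h']; exact (φ x).2

theorem tensor_induction (hT : IsNATensorSq K N T t) {P : T → Prop}
    (ht : ∀ a b, P (t a b)) (h0 : P 0) (ha : ∀ x y, P x → P y → P (x + y))
    (hs : ∀ (r : K) x, P x → P (r • x)) (x : T) : P x := by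
  let V := Submodule.span K {x : T | ∃ a b, x = t a b}
  have hV : ∀ x y, x ∈ V → y ∈ V → ⁅x, y⁆ ∈ V := by
    intro x y hx hy
    induction hx using Submodule.span_induction with
    | zero => simp
    | add u v _ _ hu hv => rw [add_lie]; exact V.add_mem hu hv
    | smul r u _ hu => rw [smul_lie]; exact V.smul_mem r hu
    | mem u hu =>
      obtain ⟨a, b, rfl⟩ := hu
      induction hy using Submodule.span_induction with
      | zero => simp
      | add u v _ _ hu hv => rw [lie_add]; exact V.add_mem hu hv
      | smul r u _ hu => rw [lie_smul]; exact V.smul_mem r hu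
      | mem u hu =>
        obtain ⟨a', b', rfl⟩ := hu
        rw [tensor_rel4 hT]
        exact Submodule.subset_span ⟨_, _, rfl⟩
  let L : LieSubalgebra K T := { V with lie_mem' := fun {x y} hx hy => hV x y hx hy }
  have hx : x ∈ V := by
    show x ∈ L
    have : LieSubalgebra.lieSpan K T {x | ∃ a b, x = t a b} ≤ L :=
      LieSubalgebra.lieSpan_le.2 Submodule.subset_span
    rw [tensor_span hT] at this
    exact this trivial
  induction hx using Submodule.span_induction with
  | zero => exact h0
  | add u v _ _ hu hv => exact ha _ _ hu hv
  | smul r u _ hu => exact hs _ _ hu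
  | mem u hu => obtain ⟨a, b, rfl⟩ := hu; exact ht a b

theorem tensor_lie (hT : IsNATensorSq K N T t) (g : T →ₗ⁅K⁆ N) (hg : ∀ a b, g (t a b) = ⁅a, b⁆)
    (x y : T) : ⁅x, y⁆ = t (g x) (g y) := by
  induction x using tensor_induction hT with
  | h0 => simp
  | ha u v hu hv => simp [hu, hv]
  | hs r u hu => simp [hu]
  | ht a b =>
    induction y using tensor_induction hT with
    | h0 => simp
    | ha u v hu hv => simp [hu, hv]
    | hs r u hu => simp [hu]
    | ht a' b' => rw [tensor_rel4 hT, hg, hg]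

end tensor

theorem univ_of_perfect {K M N T : Type u} [CommRing K] [LieRing M] [LieAlgebra K M]
    [LieRing N] [LieAlgebra K N] {d : M →ₗ⁅K⁆ N} {act : N →ₗ[K] M →ₗ[K] M}
    {br : N →ₗ[K] N →ₗ[K] M} (hX : LieXMod K M N d act)
    (hB : LieBraiding K M N d act br) [LieRing T] [LieAlgebra K T] {t : N →ₗ[K] N →ₗ[K] T}
    (hT : IsNATensorSq K N T t)
    (hM : LieSubalgebra.lieSpan K M {x : M | ∃ n n' : N, x = br n n'} = ⊤)
    (hN : LieSubalgebra.lieSpan K N {x : N | ∃ a b : N, x = ⁅a, b⁆} = ⊤) :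
    ∃ E : CentralExtOf K M N d act br, ∀ F, ∃! h, IsMor E F h := by
  obtain ⟨f, hf, -⟩ := tensor_lift hT M br hB.b5 hB.b6
    (fun a b a' b' => by rw [← hB.b2, hB.b1, hB.b1])
  have hg : ∀ a b, (d.comp f) (t a b) = ⁅a, b⁆ := fun a b => by
    rw [LieHom.comp_apply, hf, hB.b1]
  have hl := tensor_lie hT (d.comp f) hg
  have sf : Function.Surjective f := by
    rw [← LieHom.range_eq_top, eq_top_iff, ← hM, LieSubalgebra.lieSpan_le]
    rintro _ ⟨a, b, rfl⟩
    exact ⟨t a b, hf a b⟩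
  have sg : Function.Surjective (d.comp f) := by
    rw [← LieHom.range_eq_top, eq_top_iff, ← hN, LieSubalgebra.lieSpan_le]
    rintro _ ⟨a, b, rfl⟩
    exact ⟨t a b, hg a b⟩
  let E : CentralExtOf K M N d act br :=
    { X₁ := T
      X₂ := T
      δ := LieHom.id
      actX := bracketMap K T
      brX := bracketMap K T
      isXMod :=
        { act_lie := fun a b c => lie_lie a b c
          lie_act := fun a b c => leibniz_lie a b c
          equivar := fun _ _ => rfl
          peiffer := fun _ _ => rfl }
      isBraid :=
        { b1 := fun _ _ => rfl
          b2 := fun _ _ => rfl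
          b3 := fun m n => (lie_skew m n).symm
          b4 := fun _ _ => rfl
          b5 := fun a b c => by
            simp only [bracketMap_ap]
            rw [leibniz_lie a b c, ← lie_skew b ⁅a, c⁆, sub_eq_add_neg]
          b6 := fun a b c => lie_lie a b c }
      f₁ := f
      f₂ := d.comp f
      morph_act := fun x y => by
        rw [bracketMap_ap, LieHom.map_lie, LieHom.comp_apply, hX.peiffer]
      morph_d := fun _ => rfl
      morph_br := fun x y => by
        rw [bracketMap_ap, LieHom.map_lie, LieHom.comp_apply, LieHom.comp_apply, hB.b2]
      surj₁ := sf
      surj₂ := sg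
      central₁ := fun x hx y => by
        rw [bracketMap_ap, hl, LieHom.comp_apply d f x, hx, map_zero, map_zero]
      central₂ := fun x hx y => by
        rw [bracketMap_ap, bracketMap_ap, hl, hl, hx]
        simp }
  refine ⟨E, fun F => ?_⟩
  obtain ⟨s, hs⟩ := exists_pairing F
  obtain ⟨φ, hφ, huniq⟩ := tensor_lift hT F.X₁ s
    (by
      intro a b c
      obtain ⟨a, rfl⟩ := F.surj₂ a
      obtain ⟨b, rfl⟩ := F.surj₂ b
      obtain ⟨c, rfl⟩ := F.surj₂ c
      simp only [← LieHom.map_lie, hs]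
      exact F.isBraid.b5 a b c)
    (by
      intro a b c
      obtain ⟨a, rfl⟩ := F.surj₂ a
      obtain ⟨b, rfl⟩ := F.surj₂ b
      obtain ⟨c, rfl⟩ := F.surj₂ c
      simp only [← LieHom.map_lie, hs]
      exact F.isBraid.b6 a b c)
    (by
      intro a b a' b'
      obtain ⟨a, rfl⟩ := F.surj₂ a
      obtain ⟨b, rfl⟩ := F.surj₂ b
      obtain ⟨a', rfl⟩ := F.surj₂ a'
      obtain ⟨b', rfl⟩ := F.surj₂ b'
      simp only [← LieHom.map_lie, hs]
      rw [← F.isBraid.b2, F.isBraid.b1, F.isBraid.b1])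
  have hff : ∀ x : T, F.f₁ (φ x) = f x := by
    intro x
    induction x using tensor_induction hT with
    | h0 => simp
    | ha u v hu hv => simp [hu, hv]
    | hs r u hu => simp [hu]
    | ht a b =>
      rw [hφ, hf]
      obtain ⟨a, rfl⟩ := F.surj₂ a
      obtain ⟨b, rfl⟩ := F.surj₂ b
      rw [hs, F.morph_br]
  refine ⟨(φ, F.δ.comp φ), ⟨?_, ?_, ?_, hff, ?_⟩, ?_⟩
  · intro x ξ
    exact (φ.map_lie x ξ).trans (F.isXMod.peiffer _ _).symm
  · intro ξ; rfl
  · intro x y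
    exact (φ.map_lie x y).trans (F.isBraid.b2 _ _).symm
  · intro x
    show F.f₂ (F.δ (φ x)) = d (f x)
    rw [← F.morph_d, hff]
  · rintro ⟨h1, h2⟩ ⟨-, c2, c3, -, c5⟩
    have e1 : h1 = φ := by
      apply huniq
      intro a b
      obtain ⟨u, rfl⟩ := sg a
      obtain ⟨v, rfl⟩ := sg b
      have := c3 u v
      have h5 : ∀ w : T, F.f₂ (h2 w) = (d.comp f) w := c5
      rw [← hl, ← h5, ← h5, hs]
      exact this
    subst e1
    refine Prod.ext rfl ?_
    ext x
    exact (c2 x).symm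

theorem has_universal_central_extension_iff_perfect (K : Type u) [CommRing K] (M N : Type u) [LieRing M] [LieAlgebra K M]
    [LieRing N] [LieAlgebra K N] (d : M →ₗ⁅K⁆ N) (act : N →ₗ[K] M →ₗ[K] M)
    (br : N →ₗ[K] N →ₗ[K] M) (hX : LieXMod K M N d act)
    (hB : LieBraiding K M N d act br)
    (T : Type u) [LieRing T] [LieAlgebra K T] (t : N →ₗ[K] N →ₗ[K] T)
    (hT : IsNATensorSq K N T t) :
    (∃ E : CentralExtOf K M N d act br,
        ∀ F : CentralExtOf K M N d act br,
          ∃! h : (E.X₁ →ₗ⁅K⁆ F.X₁) × (E.X₂ →ₗ⁅K⁆ F.X₂),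
            (∀ (x : E.X₂) (ξ : E.X₁), h.1 (E.actX x ξ) = F.actX (h.2 x) (h.1 ξ)) ∧
            (∀ ξ : E.X₁, F.δ (h.1 ξ) = h.2 (E.δ ξ)) ∧
            (∀ x y : E.X₂, h.1 (E.brX x y) = F.brX (h.2 x) (h.2 y)) ∧
            (∀ ξ : E.X₁, F.f₁ (h.1 ξ) = E.f₁ ξ) ∧
            (∀ x : E.X₂, F.f₂ (h.2 x) = E.f₂ x)) ↔
      (LieSubalgebra.lieSpan K M {x : M | ∃ n n' : N, x = br n n'} = ⊤ ∧
      LieSubalgebra.lieSpan K N {x : N | ∃ a b : N, x = ⁅a, b⁆} = ⊤) := by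
  constructor
  · rintro ⟨E, hE⟩
    obtain ⟨h1, h2⟩ := perfect_of_univ hX hB E hE
    constructor
    · rw [eq_top_iff]
      intro x _
      have hx : x ∈ Submodule.span K {x : M | ∃ n n' : N, x = br n n'} := h1 ▸ trivial
      exact LieSubalgebra.submodule_span_le_lieSpan hx
    · rw [eq_top_iff]
      intro x _
      have hx : x ∈ Submodule.span K {x : N | ∃ a b : N, x = ⁅a, b⁆} := h2 ▸ trivial
      exact LieSubalgebra.submodule_span_le_lieSpan hx
  · rintro ⟨hM, hN⟩
    exact univ_of_perfect hX hB hT hM hN
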